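/- arXiv:1011.6131 — 2 statements merged into one kernel-verified Lean document; each statement's English description precedes it below -/
import Mathlib

section
/- Let n ≥ 1 be an integer. There exist positive real constants γ_0, …, γ_{n−1} and real constants δ_{i,j} with 0 < δ_{i,j} < 1 (for 0 ≤ i ≤ n−1 and 1 ≤ j ≤ n−1) such that the following identity holds in the polynomial ring ℝ[S,T]: S^{n−1} + S^{n−2}(S−T) + ⋯ + (S−T)^{n−1} = Σ_{i=0}^{n−1} γ_i · Π_{j=1}^{n−1} (S − δ_{i,j} T). (Equivalently, Σ_{i=0}^{n−1} S^{n−1−i}(S−T)^{i} = Σ_{i=0}^{n−1} γ_i · Π_{j=1}^{n−1} (S − δ_{i,j} T).) -/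
open MvPolynomial Finset

/-- Multiplying a binary form, given by its coefficients `c`, by the linear form `x * A + y * B`. -/
lemma linear_mul_sum_range {R : Type*} [CommRing R] (A B x y : R) (c : ℕ → R) (m : ℕ)
    (hc : c (m + 1) = 0) :
    (x * A + y * B) * ∑ k ∈ range (m + 1), c k * (A ^ (m - k) * B ^ k) =
      ∑ k ∈ range (m + 1 + 1),
        (x * c k + y * (if k = 0 then 0 else c (k - 1))) * (A ^ (m + 1 - k) * B ^ k) := by
  simp only [add_mul (x * c _), sum_add_distrib]
  rw [sum_range_succ (fun k => x * c k * (A ^ (m + 1 - k) * B ^ k)), hc,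
    sum_range_succ' (fun k => y * (if k = 0 then 0 else c (k - 1)) * (A ^ (m + 1 - k) * B ^ k)),
    add_mul, mul_sum, mul_sum]
  simp only [mul_zero, zero_mul, add_zero, if_true, Nat.add_one_ne_zero, if_false,
    Nat.add_sub_cancel, Nat.add_sub_add_right]
  congr 1
  · refine sum_congr rfl fun k hk => ?_
    have hk' : m + 1 - k = (m - k) + 1 := by have := mem_range.1 hk; omega
    rw [hk', pow_succ]
    ring
  · exact sum_congr rfl fun k _ => by ring

/-- The form `(A - t B) ^ p * (B - t A) ^ q` has coefficients depending continuously on `t`,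
and at `t = 0` it is `A ^ p * B ^ q`. -/
lemma exists_continuous_coeff (R : Type*) [CommRing R] [Algebra ℝ R] (p q : ℕ) :
    ∃ c : ℕ → ℝ → ℝ, (∀ k, Continuous (c k)) ∧ (∀ k, c k 0 = if k = q then 1 else 0) ∧
      (∀ k t, p + q < k → c k t = 0) ∧
      ∀ (t : ℝ) (A B : R),
        (A - algebraMap ℝ R t * B) ^ p * (B - algebraMap ℝ R t * A) ^ q =
          ∑ k ∈ range (p + q + 1), algebraMap ℝ R (c k t) * (A ^ (p + q - k) * B ^ k) := by
  induction p with
  | zero =>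
    induction q with
    | zero =>
      refine ⟨fun k _ => if k = 0 then 1 else 0, fun k => continuous_const, fun k => rfl,
        fun k t hk => if_neg (by omega), fun t A B => by simp⟩
    | succ q ih =>
      obtain ⟨c, hcont, hzero, hdeg, hc⟩ := ih
      refine ⟨fun k t => -t * c k t + 1 * (if k = 0 then 0 else c (k - 1) t), fun k => ?_,
        fun k => ?_, fun k t hk => ?_, fun t A B => ?_⟩
      · dsimp only
        split_ifs <;> fun_prop
      · rcases k with _ | k <;> simp [hzero]
      · have hk0 : k ≠ 0 := by omega
        simp [hk0, hdeg k t (by omega), hdeg (k - 1) t (by omega)]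
      · have key := linear_mul_sum_range A B (algebraMap ℝ R (-t)) (algebraMap ℝ R 1)
          (fun k => algebraMap ℝ R (c k t)) (0 + q) (by rw [hdeg _ t (by omega), map_zero])
        rw [← hc t A B] at key
        rw [← add_assoc]
        convert key using 1
        · simp only [map_neg, map_one]
          ring
        · refine sum_congr rfl fun k _ => ?_
          simp only [map_add, map_mul, apply_ite (algebraMap ℝ R), map_zero]
  | succ p ih =>
    obtain ⟨c, hcont, hzero, hdeg, hc⟩ := ih
    refine ⟨fun k t => 1 * c k t + -t * (if k = 0 then 0 else c (k - 1) t), fun k => ?_,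
      fun k => ?_, fun k t hk => ?_, fun t A B => ?_⟩
    · dsimp only
      split_ifs <;> fun_prop
    · simp [hzero]
    · have hk0 : k ≠ 0 := by omega
      simp [hk0, hdeg k t (by omega), hdeg (k - 1) t (by omega)]
    · have key := linear_mul_sum_range A B (algebraMap ℝ R 1) (algebraMap ℝ R (-t))
        (fun k => algebraMap ℝ R (c k t)) (p + q) (by rw [hdeg _ t (by omega), map_zero])
      rw [← hc t A B] at key
      rw [add_right_comm p 1 q]
      convert key using 1
      · simp only [map_neg, map_one]
        ring
      · refine sum_congr rfl fun k _ => ?_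
        simp only [map_add, map_mul, apply_ite (algebraMap ℝ R), map_zero]

/-- For some `t ∈ (0, 1)` the form `∑ i, (A - t B) ^ (m - i) * (B - t A) ^ i` has positive
coefficients. -/
lemma exists_pos_coeff (R : Type*) [CommRing R] [Algebra ℝ R] (m : ℕ) :
    ∃ (t : ℝ) (g : ℕ → ℝ), 0 < t ∧ t < 1 ∧ (∀ k ≤ m, 0 < g k) ∧
      ∀ A B : R,
        ∑ i ∈ range (m + 1), (A - algebraMap ℝ R t * B) ^ (m - i) *
            (B - algebraMap ℝ R t * A) ^ i =
          ∑ k ∈ range (m + 1), algebraMap ℝ R (g k) * (A ^ (m - k) * B ^ k) := by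
  choose c hcont hzero _ hc using fun i => exists_continuous_coeff R (m - i) i
  have hpos : ∀ᶠ t in nhds (0 : ℝ), ∀ k ∈ range (m + 1), 0 < ∑ i ∈ range (m + 1), c i k t := by
    rw [Filter.eventually_all_finset]
    intro k hk
    have hk0 : 0 < ∑ i ∈ range (m + 1), c i k 0 := by
      simp only [hzero, sum_ite_eq, if_pos hk, zero_lt_one]
    exact (continuous_finsetSum _ fun i _ => hcont i k).continuousAt.eventually
      (lt_mem_nhds hk0)
  obtain ⟨ε, hε, hball⟩ := Metric.eventually_nhds_iff.1 hpos
  have hmin : 0 < min ε 1 := lt_min hε one_pos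
  have hε' := min_le_left ε 1
  have h1 := min_le_right ε 1
  refine ⟨min ε 1 / 2, fun k => ∑ i ∈ range (m + 1), c i k (min ε 1 / 2), by linarith,
    by linarith, fun k hk => hball ?_ k (mem_range.2 (by omega)), fun A B => ?_⟩
  · rw [Real.dist_0_eq_abs, abs_of_pos (by linarith)]
    linarith
  · simp only [map_sum, sum_mul]
    rw [sum_comm]
    refine sum_congr rfl fun i hi => ?_
    have him : m - i + i = m := by have := mem_range.1 hi; omega
    rw [hc, him]

lemma prod_Icc_ite_le {M : Type*} [CommMonoid M] (a b : M) (m k : ℕ) (hk : k ≤ m) :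
    ∏ j ∈ Icc 1 m, (if j ≤ m - k then a else b) = a ^ (m - k) * b ^ k := by
  rw [prod_ite, prod_const, prod_const]
  have ha : {j ∈ Icc 1 m | j ≤ m - k} = Icc 1 (m - k) := by
    ext j
    simp only [mem_filter, mem_Icc]
    omega
  have hb : {j ∈ Icc 1 m | ¬ j ≤ m - k} = Icc (m - k + 1) m := by
    ext j
    simp only [mem_filter, mem_Icc]
    omega
  rw [ha, hb, Nat.card_Icc, Nat.card_Icc]
  congr 2
  omega

/-- Lemma (polynomial decomposition): for `n ≥ 1` there are positive constants `γ i`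
and constants `δ i j ∈ (0,1)` such that
`S^{n-1} + S^{n-2}(S-T) + ⋯ + (S-T)^{n-1} = Σ_i γ_i Π_j (S - δ_{i,j} T)` in `ℝ[S,T]`. -/
theorem polynomial_decomposition (n : ℕ) (hn : 1 ≤ n) :
    ∃ (γ : ℕ → ℝ) (δ : ℕ → ℕ → ℝ),
      (∀ i, i < n → 0 < γ i) ∧
      (∀ i, i < n → ∀ j, 1 ≤ j → j ≤ n - 1 → 0 < δ i j ∧ δ i j < 1) ∧
      (∑ i ∈ Finset.range n,
          (X 0 : MvPolynomial (Fin 2) ℝ) ^ (n - 1 - i) * (X 0 - X 1) ^ i) =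
        ∑ i ∈ Finset.range n, C (γ i) *
          ∏ j ∈ Finset.Icc 1 (n - 1), (X 0 - C (δ i j) * X 1) := by
  obtain ⟨m, rfl⟩ : ∃ m, n = m + 1 := ⟨n - 1, by omega⟩
  obtain ⟨t, g, ht0, ht1, hg, hsum⟩ := exists_pos_coeff (MvPolynomial (Fin 2) ℝ) m
  simp only [algebraMap_eq] at hsum
  simp only [Nat.add_sub_cancel]
  have ht : 0 < 1 - t ^ 2 := by nlinarith
  refine ⟨fun k => ((1 - t ^ 2) ^ m)⁻¹ * (g k * (1 + t) ^ m),
    fun k j => if j ≤ m - k then t / (1 + t) else 1 / (1 + t), fun k hk => ?_,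
    fun k _ j _ _ => ?_, ?_⟩
  · have := hg k (by omega)
    positivity
  · dsimp only
    split_ifs
    · exact ⟨by positivity, (div_lt_one (by positivity)).2 (by linarith)⟩
    · exact ⟨by positivity, (div_lt_one (by positivity)).2 (by linarith)⟩
  set S : MvPolynomial (Fin 2) ℝ := X 0
  set T : MvPolynomial (Fin 2) ℝ := X 1
  have hA : S + C t * (S - T) = C (1 + t) * (S - C (t / (1 + t)) * T) := by
    have h : (C (1 + t) * C (t / (1 + t)) : MvPolynomial (Fin 2) ℝ) = C t := by
      rw [← C_mul, mul_div_cancel₀ _ (by positivity)]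
    rw [mul_sub (C (1 + t)), ← mul_assoc (C (1 + t)), h, C_add, C_1]
    ring
  have hB : S - T + C t * S = C (1 + t) * (S - C (1 / (1 + t)) * T) := by
    have h : (C (1 + t) * C (1 / (1 + t)) : MvPolynomial (Fin 2) ℝ) = 1 := by
      rw [← C_mul, mul_div_cancel₀ _ (by positivity), C_1]
    rw [mul_sub (C (1 + t)), ← mul_assoc (C (1 + t)), h, C_add, C_1]
    ring
  have hscaled : C ((1 - t ^ 2) ^ m) * ∑ i ∈ range (m + 1), S ^ (m - i) * (S - T) ^ i =
      ∑ k ∈ range (m + 1), C (g k * (1 + t) ^ m) *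
        ((S - C (t / (1 + t)) * T) ^ (m - k) * (S - C (1 / (1 + t)) * T) ^ k) := by
    have h := hsum (S + C t * (S - T)) (S - T + C t * S)
    have hU : S + C t * (S - T) - C t * (S - T + C t * S) = C (1 - t ^ 2) * S := by
      simp only [C_sub, C_pow, C_1]
      ring
    have hV : S - T + C t * S - C t * (S + C t * (S - T)) = C (1 - t ^ 2) * (S - T) := by
      simp only [C_sub, C_pow, C_1]
      ring
    rw [hU, hV, hA, hB] at h
    rw [mul_sum]
    convert h using 1 <;> refine sum_congr rfl fun k hk => ?_
    all_goals
      obtain ⟨l, rfl⟩ : ∃ l, m = l + k := ⟨m - k, by have := mem_range.1 hk; omega⟩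
      rw [Nat.add_sub_cancel]
      simp only [C_mul, C_pow, mul_pow, pow_add]
      ring
  have hinv : (C ((1 - t ^ 2) ^ m)⁻¹ * C ((1 - t ^ 2) ^ m) : MvPolynomial (Fin 2) ℝ) = 1 := by
    rw [← C_mul, inv_mul_cancel₀ (by positivity), C_1]
  rw [← one_mul (∑ i ∈ range (m + 1), S ^ (m - i) * (S - T) ^ i), ← hinv, mul_assoc, hscaled,
    mul_sum]
  refine sum_congr rfl fun k hk => ?_
  dsimp only
  rw [← prod_Icc_ite_le _ _ m k (by have := mem_range.1 hk; omega), ← mul_assoc, ← C_mul]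
  congr 1
  refine prod_congr rfl fun j _ => ?_
  split_ifs <;> rfl
end

section
/- For every integer n ≥ 2 and every integer s with 0 ≤ s ≤ n−1, there exist integers m_1, …, m_n such that T^{s} = Σ_{i=1}^{n} m_i (T−1)^{n−i} T^{i−1} in the polynomial ring ℤ[T]. -/
open Polynomial

/-- For `n ≥ 2` and `0 ≤ s ≤ n-1`, the monomial `T^s` is an integer linear combination
of the polynomials `(T-1)^{n-i} T^{i-1}`, `1 ≤ i ≤ n`, in `ℤ[T]`. -/
theorem monomial_in_span (n s : ℕ) (hn : 2 ≤ n) (hs : s ≤ n - 1) :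
    ∃ m : ℕ → ℤ,
      (X : ℤ[X]) ^ s =
        ∑ i ∈ Finset.Icc 1 n, C (m i) * (X - 1) ^ (n - i) * X ^ (i - 1) := by
  -- Expand `X ^ s * (X - (X - 1)) ^ k` with `k = n - 1 - s` by the binomial theorem.
  obtain ⟨k, rfl⟩ : ∃ k, n = s + (k + 1) := ⟨n - 1 - s, by omega⟩
  refine ⟨fun i => if s < i then (-1) ^ (s + (k + 1) - i) * (k.choose (i - 1 - s) : ℤ) else 0, ?_⟩
  have binomial_expansion := add_pow (X : ℤ[X]) (-(X - 1)) k
  rw [show (X : ℤ[X]) + -(X - 1) = 1 by ring, one_pow] at binomial_expansion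
  rw [← Finset.Ico_add_one_right_eq_Icc, Finset.sum_Ico_eq_sum_range, Nat.add_sub_cancel,
    Finset.sum_range_add, Finset.sum_eq_zero, zero_add]
  · conv_lhs => rw [← mul_one (X ^ s), binomial_expansion, Finset.mul_sum]
    refine Finset.sum_congr rfl fun j _ => ?_
    beta_reduce
    rw [if_pos (by omega), show s + (k + 1) - (1 + (s + j)) = k - j by omega,
      show 1 + (s + j) - 1 = s + j by omega, Nat.add_sub_cancel_left, neg_pow (X - 1 : ℤ[X])]
    simp only [map_mul, map_pow, map_neg, map_one, map_natCast]
    ring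
  · intro i hi
    have := Finset.mem_range.mp hi
    beta_reduce
    rw [if_neg (by omega), map_zero, zero_mul, zero_mul]
end
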